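/- Under the standing hypotheses, no two distinct g-cycles of G share two consecutive edges; that is, there do not exist cycles C and D of length g in G with different edge sets together with vertices a, b, c such that both edges ab and bc belong to both C and D. -/

import Mathlib

open SimpleGraph

/-- Two graphs have the same `k`-deck if there is a bijection between their `k`-element
vertex subsets under which corresponding induced subgraphs are isomorphic. -/
def SameDeck {V W : Type*} [Fintype V] [Fintype W] [DecidableEq V] [DecidableEq W]
    (G : SimpleGraph V) (H : SimpleGraph W) (k : ℕ) : Prop :=
  ∃ e : {s : Finset V // s.card = k} ≃ {s : Finset W // s.card = k},
    ∀ s : {s : Finset V // s.card = k},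
      Nonempty ((G.induce (↑s.1 : Set V)) ≃g (H.induce (↑(e s).1 : Set W)))

theorem sum_eq_add_add_sum_compl_pair {V : Type*} [Fintype V] [DecidableEq V]
    {a b : V} (hab : a ≠ b) (f : V → ℕ) :
    ∑ v, f v = f a + f b + ∑ v ∈ ({a, b} : Finset V)ᶜ, f v := by
  rw [← Finset.sum_add_sum_compl ({a, b} : Finset V) f, Finset.sum_pair hab]

theorem sum_ite_adj_eq_three {V : Type*} [Fintype V] (K : SimpleGraph V)
    [DecidableRel K.Adj] (hK : K.IsRegularOfDegree 3) (u : V) :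
    ∑ v, (if K.Adj u v then 1 else 0) = 3 := by
  rw [← hK u, ← SimpleGraph.card_neighborFinset_eq_degree, SimpleGraph.neighborFinset_eq_filter,
    Finset.card_filter]

/-- Cubic graphs agreeing off `{a, b}` give each remaining vertex equally many neighbours
in `{a, b}`. -/
theorem ite_adj_add_ite_adj_eq {V : Type*} [Fintype V] [DecidableEq V] (G H : SimpleGraph V)
    [DecidableRel G.Adj] [DecidableRel H.Adj]
    (hG : G.IsRegularOfDegree 3) (hH : H.IsRegularOfDegree 3) {a b : V} (hab : a ≠ b)
    (hag : ∀ u v, u ≠ a → u ≠ b → v ≠ a → v ≠ b → (G.Adj u v ↔ H.Adj u v))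
    {w : V} (hwa : w ≠ a) (hwb : w ≠ b) :
    (if G.Adj w a then 1 else 0) + (if G.Adj w b then 1 else 0) =
      (if H.Adj w a then 1 else 0) + (if H.Adj w b then 1 else 0) := by
  have h1 := sum_ite_adj_eq_three G hG w
  have h2 := sum_ite_adj_eq_three H hH w
  rw [sum_eq_add_add_sum_compl_pair hab] at h1 h2
  have h3 : ∑ v ∈ ({a, b} : Finset V)ᶜ, (if G.Adj w v then 1 else 0) =
      ∑ v ∈ ({a, b} : Finset V)ᶜ, (if H.Adj w v then 1 else 0) := by
    refine Finset.sum_congr rfl fun v hv => ?_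
    simp only [Finset.mem_compl, Finset.mem_insert, Finset.mem_singleton, not_or] at hv
    simp only [hag w v hwa hwb hv.1 hv.2]
  omega

theorem adj_iff_of_agree_off_pair {V : Type*} [Fintype V] [DecidableEq V] (G H : SimpleGraph V)
    [DecidableRel G.Adj] [DecidableRel H.Adj]
    (hG : G.IsRegularOfDegree 3) (hH : H.IsRegularOfDegree 3) {a b : V} (hab : a ≠ b)
    (hag : ∀ u v, u ≠ a → u ≠ b → v ≠ a → v ≠ b → (G.Adj u v ↔ H.Adj u v)) :
    G.Adj a b ↔ H.Adj a b := by
  have h1 := sum_ite_adj_eq_three G hG a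
  have h2 := sum_ite_adj_eq_three H hH a
  have h3 := sum_ite_adj_eq_three G hG b
  have h4 := sum_ite_adj_eq_three H hH b
  rw [sum_eq_add_add_sum_compl_pair hab] at h1 h2 h3 h4
  have h5 : ∑ v ∈ ({a, b} : Finset V)ᶜ,
        ((if G.Adj a v then 1 else 0) + (if G.Adj b v then 1 else 0)) =
      ∑ v ∈ ({a, b} : Finset V)ᶜ,
        ((if H.Adj a v then 1 else 0) + (if H.Adj b v then 1 else 0)) := by
    refine Finset.sum_congr rfl fun v hv => ?_
    simp only [Finset.mem_compl, Finset.mem_insert, Finset.mem_singleton, not_or] at hv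
    simpa only [SimpleGraph.adj_comm] using
      ite_adj_add_ite_adj_eq G H hG hH hab hag hv.1 hv.2
  rw [Finset.sum_add_distrib, Finset.sum_add_distrib] at h5
  simp only [SimpleGraph.irrefl, if_false, G.adj_comm b a, H.adj_comm b a] at h1 h2 h3 h4
  by_cases hx : G.Adj a b <;> by_cases hy : H.Adj a b <;> 
    simp only [hx, hy, if_true, if_false] at * <;> omega

theorem eq_or_eq_of_adj_of_isRegularOfDegree_three {V : Type*} [Fintype V] [DecidableEq V]
    (K : SimpleGraph V) [DecidableRel K.Adj] (hK : K.IsRegularOfDegree 3) {v x y z w : V}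
    (hxy : x ≠ y) (hxz : x ≠ z) (hyz : y ≠ z)
    (hx : K.Adj v x) (hy : K.Adj v y) (hz : K.Adj v z) (hw : K.Adj v w) :
    w = x ∨ w = y ∨ w = z := by
  have h : ({x, y, z} : Finset V) = K.neighborFinset v := by
    refine Finset.eq_of_subset_of_card_le ?_ ?_
    · intro u hu
      simp only [Finset.mem_insert, Finset.mem_singleton] at hu
      rcases hu with rfl | rfl | rfl <;> simpa
    · rw [K.card_neighborFinset_eq_degree, hK v, Finset.card_eq_three.2 ⟨x, y, z, hxy, hxz, hyz, rfl⟩]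
  have hw' : w ∈ ({x, y, z} : Finset V) := by rw [h]; simpa
  simpa using hw'

theorem exists_third_adj {V : Type*} [Fintype V] [DecidableEq V]
    (K : SimpleGraph V) [DecidableRel K.Adj] (hK : K.IsRegularOfDegree 3) (v x y : V) :
    ∃ z, K.Adj v z ∧ z ≠ x ∧ z ≠ y := by
  by_contra! h
  have h1 : K.neighborFinset v ⊆ {x, y} := by
    intro z hz
    have := h z (by simpa using hz)
    simp only [Finset.mem_insert, Finset.mem_singleton]
    tauto
  have h2 := Finset.card_le_card h1
  rw [K.card_neighborFinset_eq_degree, hK v] at h2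
  have := Finset.card_le_two (a := x) (b := y)
  omega

theorem SameDeck.symm {V W : Type*} [Fintype V] [Fintype W] [DecidableEq V] [DecidableEq W]
    {G : SimpleGraph V} {H : SimpleGraph W} {k : ℕ} (h : SameDeck G H k) : SameDeck H G k := by
  obtain ⟨e, he⟩ := h
  refine ⟨e.symm, fun s => ?_⟩
  have := he (e.symm s)
  rw [e.apply_symm_apply] at this
  exact this.map SimpleGraph.Iso.symm

theorem SameDeck.exists_equiv {V W : Type*} [Fintype V] [Fintype W] [DecidableEq V]
    [DecidableEq W] {G : SimpleGraph V} {H : SimpleGraph W}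
    (hcard : Fintype.card V = Fintype.card W) (h : SameDeck G H (Fintype.card V - 2))
    {a b : V} (hab : a ≠ b) :
    ∃ ψ : V ≃ W, ∀ u v, u ≠ a → u ≠ b → v ≠ a → v ≠ b →
      (G.Adj u v ↔ H.Adj (ψ u) (ψ v)) := by
  obtain ⟨e, he⟩ := h
  let s : {s : Finset V // s.card = Fintype.card V - 2} :=
    ⟨({a, b} : Finset V)ᶜ, by rw [Finset.card_compl, Finset.card_pair hab]⟩
  obtain ⟨φ⟩ := he s
  have hc : Fintype.card ↥((↑s.1 : Set V)ᶜ) = Fintype.card ↥((↑(e s).1 : Set W)ᶜ) := by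
    rw [Fintype.card_compl_set, Fintype.card_compl_set, Fintype.card_congr φ.toEquiv, ← hcard]
  let ε := Fintype.equivOfCardEq hc
  let ψ : V ≃ W := ((Equiv.Set.sumCompl (↑s.1 : Set V)).symm.trans
    (Equiv.sumCongr φ.toEquiv ε)).trans (Equiv.Set.sumCompl (↑(e s).1 : Set W))
  have hψ : ∀ u (hu : u ∈ (↑s.1 : Set V)), ψ u = (φ ⟨u, hu⟩ : W) := by
    intro u hu
    simp only [ψ, Equiv.trans_apply, Equiv.Set.sumCompl_symm_apply_of_mem hu]
    exact Equiv.Set.sumCompl_apply_inl _ _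
  refine ⟨ψ, fun u v hua hub hva hvb => ?_⟩
  have hu : u ∈ (↑s.1 : Set V) := by simp [s, hua, hub]
  have hv : v ∈ (↑s.1 : Set V) := by simp [s, hva, hvb]
  rw [hψ u hu, hψ v hv]
  exact (φ.map_adj_iff (v := ⟨u, hu⟩) (w := ⟨v, hv⟩)).symm

namespace SimpleGraph.Walk

/-- A path together with a vertex off it adjacent to both ends closes up to a cycle. -/
theorem IsPath.exists_isCycle {V : Type*} {K : SimpleGraph V} {x y p : V} {T : K.Walk x y}
    (hT : T.IsPath) (hxy : x ≠ y) (hp : p ∉ T.support) (hpx : K.Adj p x) (hyp : K.Adj y p) :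
    ∃ Z : K.Walk p p, Z.IsCycle ∧ Z.length = T.length + 2 ∧
      ∀ v ∈ Z.support, v = p ∨ v ∈ T.support := by
  refine ⟨cons hpx (T.concat hyp), ?_, by simp, ?_⟩
  · rw [cons_isCycle_iff]
    refine ⟨hT.concat hp hyp, ?_⟩
    rw [edges_concat, List.concat_eq_append, List.mem_append, not_or]
    refine ⟨fun h => hp (T.fst_mem_support_of_mem_edges h), ?_⟩
    simp only [List.mem_singleton, Sym2.eq_iff, not_or, not_and]
    exact ⟨fun h => absurd h hyp.ne', fun _ h => hxy h⟩
  · intro v hv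
    simp only [support_cons, support_concat, List.mem_cons,
      List.mem_append, List.not_mem_nil, or_false] at hv
    tauto

/-- A walk avoiding `a` and `b` lives in any graph agreeing off `{a, b}`. -/
theorem edges_mem_of_agree_off_pair {V : Type*} {G H : SimpleGraph V} {a b x y : V}
    (hag : ∀ u v, u ≠ a → u ≠ b → v ≠ a → v ≠ b → (G.Adj u v ↔ H.Adj u v))
    (T : G.Walk x y) (ha : a ∉ T.support) (hb : b ∉ T.support) :
    ∀ e ∈ T.edges, e ∈ H.edgeSet := by
  intro e he
  induction e with
  | h u v =>
    have hu := T.fst_mem_support_of_mem_edges he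
    have hv := T.snd_mem_support_of_mem_edges he
    have huv := T.adj_of_mem_edges he
    exact (hag u v (by rintro rfl; exact ha hu) (by rintro rfl; exact hb hu)
      (by rintro rfl; exact ha hv) (by rintro rfl; exact hb hv)).1 huv

/-- The rest of a cycle through the consecutive edges `ab` and `bc`. -/
theorem IsCycle.exists_isPath_of_mem_edges {V : Type*} [DecidableEq V] {G : SimpleGraph V}
    {v a b c : V} {C : G.Walk v v} (hC : C.IsCycle) (hac : a ≠ c)
    (hab : s(a, b) ∈ C.edges) (hbc : s(b, c) ∈ C.edges) :
    ∃ P : G.Walk a c, P.IsPath ∧ b ∉ P.support ∧ P.length + 2 = C.length ∧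
      ∀ e, e ∈ C.edges ↔ e = s(a, b) ∨ e = s(b, c) ∨ e ∈ P.edges := by
  have hb : b ∈ C.support := C.snd_mem_support_of_mem_edges hab
  have hmem : ∀ e, e ∈ C.edges ↔ e ∈ (C.rotate b hb).edges :=
    fun e => (C.rotate_edges b hb).mem_iff.symm
  have hlen : (C.rotate b hb).length = C.length := by
    rw [← length_edges, ← length_edges]
    exact (C.rotate_edges b hb).perm.length_eq
  have hR := hC.rotate hb
  rw [hmem] at hab hbc
  simp only [hmem]
  rw [← hlen]
  generalize C.rotate b hb = R at *
  cases R with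
  | nil => exact absurd hR (by simp)
  | @cons _ y _ h T =>
    rw [cons_isCycle_iff] at hR
    obtain ⟨z, T', h', rfl⟩ : ∃ (z : V) (T' : G.Walk y z) (h' : G.Adj z b), T = T'.concat h' := by
      cases T using SimpleGraph.Walk.concatRec with
      | Hnil => exact absurd rfl h.ne
      | Hconcat p h' => exact ⟨_, p, h', rfl⟩
    obtain ⟨hP, hb'⟩ := (concat_isPath_iff _).1 hR.1
    have key : ∀ e, e ∈ (cons h (T'.concat h')).edges ↔
        e = s(b, y) ∨ e = s(z, b) ∨ e ∈ T'.edges := by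
      intro e
      simp only [edges_cons, edges_concat, List.concat_eq_append, List.mem_cons,
        List.mem_append, List.not_mem_nil, or_false]
      tauto
    have ha : a = y ∨ a = z := by
      rcases (key _).1 hab with h1 | h1 | h1
      · left; grind [Sym2.eq_iff]
      · right; grind [Sym2.eq_iff]
      · exact absurd (T'.snd_mem_support_of_mem_edges h1) hb'
    have hc : c = y ∨ c = z := by
      rcases (key _).1 hbc with h1 | h1 | h1
      · left; grind [Sym2.eq_iff]
      · right; grind [Sym2.eq_iff]
      · exact absurd (T'.fst_mem_support_of_mem_edges h1) hb'
    rcases ha with rfl | rfl <;> rcases hc with rfl | rfl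
    · exact absurd rfl hac
    · refine ⟨T', hP, hb', by simp, fun e => ?_⟩
      rw [key, @Sym2.eq_swap _ b a, @Sym2.eq_swap _ c b]
    · refine ⟨T'.reverse, hP.reverse, by simpa using hb', by simp, fun e => ?_⟩
      rw [key, edges_reverse, List.mem_reverse]
      tauto
    · exact absurd rfl hac

end SimpleGraph.Walk

/-- A path on `L` edges from `x₁` to `c`, extended by `c, b, a`, where `a` is adjacent to `x₁`,
misses every other neighbour `x₂ ≠ b` of `a` in a graph of girth at least `L + 3`. -/
theorem notMem_support_of_adj_of_girth {V : Type*} [DecidableEq V] {G : SimpleGraph V} {L : ℕ}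
    (hgirth : ∀ (v : V) (Z : G.Walk v v), Z.IsCycle → L + 3 ≤ Z.length)
    {a c x₁ x₂ : V} (hx : x₁ ≠ x₂) (ha₁ : G.Adj a x₁) (ha₂ : G.Adj a x₂)
    (T : G.Walk x₁ c) (hT : T.IsPath) (hL : T.length = L) (hTa : a ∉ T.support) :
    x₂ ∉ T.support := by
  intro h
  obtain ⟨Z, hZ, hlen, -⟩ := (hT.takeUntil h).exists_isCycle hx
    (fun h' => hTa (T.support_takeUntil_subset_support h h')) ha₁ ha₂.symm
  have h1 := hgirth _ Z hZ
  have h2 := T.length_takeUntil_le_length h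
  omega

theorem nonempty_iso_of_equiv {V : Type*} {G H : SimpleGraph V} {a b : V} (σ : V ≃ V)
    (hab : G.Adj a b) (hab' : H.Adj (σ a) (σ b)) (hσ : ∀ w, w ≠ a → w ≠ b → σ w = w)
    (hA : ∀ w, w ≠ a → w ≠ b → (G.Adj a w ↔ H.Adj (σ a) w))
    (hB : ∀ w, w ≠ a → w ≠ b → (G.Adj b w ↔ H.Adj (σ b) w))
    (hag : ∀ u v, u ≠ a → u ≠ b → v ≠ a → v ≠ b → (G.Adj u v ↔ H.Adj u v)) :
    Nonempty (G ≃g H) := by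
  have hcases : ∀ w, w = a ∨ w = b ∨ (w ≠ a ∧ w ≠ b) := fun w => by tauto
  refine ⟨⟨σ, @fun u v => ?_⟩⟩
  rcases hcases u with rfl | rfl | ⟨hua, hub⟩ <;> rcases hcases v with rfl | rfl | ⟨hva, hvb⟩
  · simp
  · simp [hab, hab']
  · rw [hσ v hva hvb, hA v hva hvb]
  · simp [hab.symm, hab'.symm]
  · simp
  · rw [hσ v hva hvb, hB v hva hvb]
  · rw [hσ u hua hub, G.adj_comm, H.adj_comm, hA u hua hub]
  · rw [hσ u hua hub, G.adj_comm, H.adj_comm, hB u hua hub]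
  · rw [hσ u hua hub, hσ v hva hvb, hag u v hua hub hva hvb]

/-- The two branches `x₁` and `x₂` at `a` of cycles of minimum length through `c, b, a` force any
cubic graph agreeing with `G` off `{a, b}`, and without short cycles, to be isomorphic to `G`. -/
theorem nonempty_iso_of_agree_off_pair {V : Type*} [Fintype V] [DecidableEq V]
    (G H : SimpleGraph V) [DecidableRel G.Adj] [DecidableRel H.Adj]
    (hG : G.IsRegularOfDegree 3) (hH : H.IsRegularOfDegree 3) {L : ℕ}
    (hgirth : ∀ (v : V) (Z : G.Walk v v), Z.IsCycle → L + 3 ≤ Z.length)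
    (hgirthH : ∀ (v p q : V) (Z : H.Walk v v), Z.IsCycle → p ≠ q → p ∉ Z.support →
      q ∉ Z.support → L + 3 ≤ Z.length)
    {a b c x₁ x₂ : V} (hab : G.Adj a b) (hbc : G.Adj b c) (hx : x₁ ≠ x₂)
    (ha₁ : G.Adj a x₁) (ha₂ : G.Adj a x₂)
    (T₁ : G.Walk x₁ c) (T₂ : G.Walk x₂ c) (hT₁ : T₁.IsPath) (hT₂ : T₂.IsPath)
    (hL₁ : T₁.length = L) (hL₂ : T₂.length = L)
    (haT₁ : a ∉ T₁.support) (hbT₁ : b ∉ T₁.support)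
    (haT₂ : a ∉ T₂.support) (hbT₂ : b ∉ T₂.support)
    (hag : ∀ u v, u ≠ a → u ≠ b → v ≠ a → v ≠ b → (G.Adj u v ↔ H.Adj u v)) :
    Nonempty (G ≃g H) := by
  have hL : L ≠ 0 := by
    rintro rfl
    exact hx ((Walk.eq_of_length_eq_zero hL₁).trans (Walk.eq_of_length_eq_zero hL₂).symm)
  have hne : ∀ {x} (T : G.Walk x c), T.IsPath → T.length = L → x ≠ c := by
    rintro x T hT hl rfl
    rw [(Walk.isPath_iff_nil.1 hT).length_eq_zero] at hl
    exact hL hl.symm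
  have hdisj : ∀ w, G.Adj w a → ¬ G.Adj w b := by
    intro w hwa hwb
    have hp : (Walk.nil.cons hab).IsPath := by simp [hab.ne]
    obtain ⟨Z, hZ, hlen, -⟩ := hp.exists_isCycle hab.ne
      (p := w) (by simp [hwa.ne, hwb.ne]) hwa hwb.symm
    have := hgirth _ Z hZ
    simp at hlen
    omega
  have hcnt := fun {w} => ite_adj_add_ite_adj_eq G H hG hH hab.ne hag (w := w)
  have hab' : H.Adj a b := (adj_iff_of_agree_off_pair G H hG hH hab.ne hag).1 hab
  have hca : c ≠ a := fun h => haT₁ (h ▸ T₁.end_mem_support)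
  have hcb : c ≠ b := hbc.ne'
  have hb₁ : b ≠ x₁ := fun h => hbT₁ (h ▸ T₁.start_mem_support)
  have hb₂ : b ≠ x₂ := fun h => hbT₂ (h ▸ T₂.start_mem_support)
  -- neighbourhoods in `H` of a vertex outside `{a, b}`
  have hex : ∀ w, w ≠ a → w ≠ b → ((G.Adj w a ∨ G.Adj w b) ↔ (H.Adj w a ∨ H.Adj w b)) ∧
      ¬ (H.Adj w a ∧ H.Adj w b) := by
    intro w hwa hwb
    have h1 := hcnt hwa hwb
    have h2 := hdisj w
    clear * - h1 h2
    split_ifs at h1 <;> first | tauto | omega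
  have main : ∀ p q : V, (p = a ∧ q = b) ∨ (p = b ∧ q = a) → H.Adj c p →
      ∃ z, z ≠ a ∧ z ≠ b ∧ z ≠ c ∧ H.Adj p z ∧ G.Adj b z := by
    intro p q hpq hcp
    obtain ⟨z, hpz, hzq, hzc⟩ := exists_third_adj H hH p q c
    have hzp := hpz.ne'
    have hz : z ≠ a ∧ z ≠ b := by rcases hpq with ⟨rfl, rfl⟩ | ⟨rfl, rfl⟩ <;> tauto
    refine ⟨z, hz.1, hz.2, hzc, hpz, ?_⟩
    have hzG : G.Adj z a ∨ G.Adj z b := by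
      rw [(hex z hz.1 hz.2).1]
      rcases hpq with ⟨rfl, rfl⟩ | ⟨rfl, rfl⟩
      · exact .inl hpz.symm
      · exact .inr hpz.symm
    refine (hzG.resolve_left fun hza => ?_).symm
    have short : ∀ x y (T : G.Walk x c), T.IsPath → T.length = L → a ∉ T.support →
        b ∉ T.support → G.Adj a x → G.Adj a y → x ≠ y → b ≠ y → H.Adj p x → False := by
      intro x y T hT hl haT hbT hax hay hxy hby hpx
      have hE := Walk.edges_mem_of_agree_off_pair hag T haT hbT
      have hyT := notMem_support_of_adj_of_girth hgirth hxy hax hay T hT hl haT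
      have hpq' : p ∉ T.support ∧ q ∉ T.support ∧ p ≠ q ∧ p ≠ y ∧ q ≠ y := by
        have := hab.ne
        have := hay.ne
        rcases hpq with ⟨rfl, rfl⟩ | ⟨rfl, rfl⟩ <;> tauto
      obtain ⟨hpT, hqT, hpq', hpy, hqy⟩ := hpq'
      obtain ⟨Z, hZ, hlen, hsup⟩ := (hT.transfer hE).exists_isCycle (hne T hT hl)
        (by simpa using hpT) hpx hcp
      have h1 := hgirthH _ q y Z hZ hqy
        (fun h => by simpa [hqT, hpq'.symm] using hsup _ h)
        (fun h => by simpa [hyT, hpy.symm] using hsup _ h)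
      simp at hlen
      omega
    rcases eq_or_eq_of_adj_of_isRegularOfDegree_three G hG hb₁ hb₂ hx hab ha₁ ha₂ hza.symm
      with h | h | h
    · exact hz.2 h
    · subst h
      exact short _ _ T₁ hT₁ hL₁ haT₁ hbT₁ ha₁ ha₂ hx hb₂ hpz
    · subst h
      exact short _ _ T₂ hT₂ hL₂ haT₂ hbT₂ ha₂ ha₁ hx.symm hb₁ hpz
  have build : ∀ p q : V, (p = a ∧ q = b) ∨ (p = b ∧ q = a) → H.Adj c p →
      (∀ w, w ≠ a → w ≠ b → (G.Adj b w ↔ H.Adj p w)) := by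
    intro p q hpq hcp w hwa hwb
    obtain ⟨z, hza, hzb, hzc, hpz, hbz⟩ := main p q hpq hcp
    have hqac : q ≠ c ∧ q ≠ z ∧ q ≠ w ∧ H.Adj p q := by
      rcases hpq with ⟨rfl, rfl⟩ | ⟨rfl, rfl⟩
      · exact ⟨hcb.symm, hzb.symm, hwb.symm, hab'⟩
      · exact ⟨hca.symm, hza.symm, hwa.symm, hab'.symm⟩
    constructor
    · intro h
      rcases eq_or_eq_of_adj_of_isRegularOfDegree_three G hG hca.symm hza.symm hzc.symm
        hab.symm hbc hbz h with h | rfl | rfl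
      · exact absurd h hwa
      · exact hcp.symm
      · exact hpz
    · intro h
      rcases eq_or_eq_of_adj_of_isRegularOfDegree_three H hH hqac.1 hqac.2.1 hzc.symm
        hqac.2.2.2 hcp.symm hpz h with h | rfl | rfl
      · exact absurd h.symm hqac.2.2.1
      · exact hbc
      · exact hbz
  rcases (hex c hca hcb).1.1 (.inr hbc.symm) with hc | hc
  · have hB := build a b (.inl ⟨rfl, rfl⟩) hc
    have hA : ∀ w, w ≠ a → w ≠ b → (G.Adj a w ↔ H.Adj b w) := by
      intro w hwa hwb
      have h1 := hex w hwa hwb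
      have h2 := hdisj w
      have h3 := hB w hwa hwb
      simp only [G.adj_comm w, H.adj_comm w] at h1 h2
      tauto
    refine nonempty_iso_of_equiv (Equiv.swap a b) hab ?_ (fun w => Equiv.swap_apply_of_ne_of_ne)
      ?_ ?_ hag
    · simpa using hab'.symm
    · simpa using hA
    · simpa using hB
  · have hB := build b a (.inr ⟨rfl, rfl⟩) hc
    have hA : ∀ w, w ≠ a → w ≠ b → (G.Adj a w ↔ H.Adj a w) := by
      intro w hwa hwb
      have h1 := hex w hwa hwb
      have h2 := hdisj w
      have h3 := hB w hwa hwb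
      simp only [G.adj_comm w, H.adj_comm w] at h1 h2
      tauto
    exact nonempty_iso_of_equiv (Equiv.refl V) hab hab' (fun _ _ _ => rfl) hA hB hag

/-- The divergence point of two distinct paths from `a` to `c`, both completed to cycles by a
common walk `R` from `c` to `b` and the edge `ba`. -/
theorem exists_divergence {V : Type*} {G : SimpleGraph V} {c : V} {L : ℕ} :
    ∀ {a : V} (P P' : G.Walk a c) {d b : V} (R : G.Walk c d), G.Adj d b →
      G.Adj a b → P ≠ P' → (P.append R).IsPath → (P'.append R).IsPath →
      b ∉ (P.append R).support → b ∉ (P'.append R).support →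
      (P.append R).length = L + 1 → (P'.append R).length = L + 1 →
      ∃ (a b c x₁ x₂ : V) (T₁ : G.Walk x₁ c) (T₂ : G.Walk x₂ c),
        G.Adj a b ∧ G.Adj b c ∧ x₁ ≠ x₂ ∧ G.Adj a x₁ ∧ G.Adj a x₂ ∧ T₁.IsPath ∧ T₂.IsPath ∧
        T₁.length = L ∧ T₂.length = L ∧ a ∉ T₁.support ∧ b ∉ T₁.support ∧
        a ∉ T₂.support ∧ b ∉ T₂.support := by
  intro a P
  induction P with
  | nil =>
    intro P' d b R _ _ hne _ hP' _ _ _ _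
    exact absurd (Walk.isPath_iff_nil.1 hP'.of_append_left).eq_nil.symm hne
  | @cons a x c h Q ih =>
    intro P' d b R hdb hab hne hP hP' hb hb' hl hl'
    cases P' with
    | nil => exact absurd (Walk.isPath_iff_nil.1 hP.of_append_left) (by simp)
    | @cons _ x' _ h' Q' =>
      simp only [Walk.cons_append, Walk.cons_isPath_iff, Walk.support_cons, List.mem_cons,
        not_or, Walk.length_cons, add_left_inj] at hP hP' hb hb' hl hl'
      by_cases hxx : x = x'
      · subst hxx
        have hQ : Q ≠ Q' := fun e => hne (by rw [e])
        have hax : a ≠ b := hab.ne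
        refine ih Q' (R.concat hdb) hab.symm h.symm hQ ?_ ?_ ?_ ?_ ?_ ?_ <;>
          rw [Walk.append_concat]
        · exact hP.1.concat hb.2 hdb
        · exact hP'.1.concat hb'.2 hdb
        · simp [hP.2, hax]
        · simp [hP'.2, hax]
        · simpa using hl
        · simpa using hl'
      · exact ⟨a, b, d, x, x', Q.append R, Q'.append R, hab, hdb.symm, hxx, h, h', hP.1, hP'.1,
          hl, hl', hP.2, hb.2, hP'.2, hb'.2⟩

/-- Standing hypotheses: `G` and `H` are 3-regular graphs on the same number `n` of vertices
with the same `(n-2)`-deck, `H` is not isomorphic to `G`, and `g` is the girth of `G`. -/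
theorem no_spliced_g_cycles
    {V W : Type*} [Fintype V] [Fintype W] [DecidableEq V] [DecidableEq W]
    (G : SimpleGraph V) (H : SimpleGraph W)
    [DecidableRel G.Adj] [DecidableRel H.Adj]
    (hG : G.IsRegularOfDegree 3) (hH : H.IsRegularOfDegree 3)
    (hcard : Fintype.card V = Fintype.card W)
    (hdeck : SameDeck G H (Fintype.card V - 2))
    (hniso : ¬ Nonempty (G ≃g H))
    (g : ℕ) (hgirth : G.egirth = g)
    :
    ¬ ∃ (v₁ v₂ : V) (C : G.Walk v₁ v₁) (D : G.Walk v₂ v₂) (a b c : V),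
      C.IsCycle ∧ D.IsCycle ∧ C.length = g ∧ D.length = g ∧
      {e | e ∈ C.edges} ≠ {e | e ∈ D.edges} ∧ a ≠ c ∧
      s(a, b) ∈ C.edges ∧ s(b, c) ∈ C.edges ∧
      s(a, b) ∈ D.edges ∧ s(b, c) ∈ D.edges := by
  rintro ⟨v₁, v₂, C, D, a, b, c, hC, hD, hCg, hDg, hne, hac, hCab, hCbc, hDab, hDbc⟩
  have hg : ∀ (v : V) (Z : G.Walk v v), Z.IsCycle → g ≤ Z.length := by
    intro v Z hZ
    have h : G.egirth ≤ Z.length := hZ.egirth_le_length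
    rw [hgirth] at h
    exact_mod_cast h
  obtain ⟨L, rfl⟩ : ∃ L, g = L + 3 := ⟨g - 3, by have := hC.three_le_length; omega⟩
  obtain ⟨P, hP, hbP, hPl, hPe⟩ := hC.exists_isPath_of_mem_edges hac hCab hCbc
  obtain ⟨P', hP', hbP', hPl', hPe'⟩ := hD.exists_isPath_of_mem_edges hac hDab hDbc
  have hPP : P ≠ P' := by
    rintro rfl
    exact hne (Set.ext fun e => (hPe e).trans (hPe' e).symm)
  obtain ⟨a, b, c, x₁, x₂, T₁, T₂, hab, hbc, hx, ha₁, ha₂, hT₁, hT₂, hL₁, hL₂, h1, h2, h3, h4⟩ :=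
    exists_divergence (L := L) P P' Walk.nil (C.adj_of_mem_edges hCbc).symm
      (C.adj_of_mem_edges hCab) hPP (by simpa) (by simpa) (by simpa) (by simpa)
      (by rw [Walk.append_nil]; omega) (by rw [Walk.append_nil]; omega)
  obtain ⟨ψ, hψ⟩ := hdeck.exists_equiv hcard hab.ne
  let H' : SimpleGraph V := H.comap ψ
  let ι : H' ≃g H := SimpleGraph.Iso.comap ψ H
  have hH' : H'.IsRegularOfDegree 3 := fun v => by rw [← ι.degree_eq, hH]
  refine hniso ((nonempty_iso_of_agree_off_pair G H' hG hH' hg ?_ hab hbc hx ha₁ ha₂ T₁ T₂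
    hT₁ hT₂ hL₁ hL₂ h1 h2 h3 h4 hψ).map fun f => f.trans ι)
  intro v p q Z hZ hpq hp hq
  have hdeck' : SameDeck H G (Fintype.card W - 2) := hcard ▸ hdeck.symm
  obtain ⟨χ, hχ⟩ := hdeck'.exists_equiv hcard.symm (ψ.injective.ne hpq)
  have hag : ∀ u v, u ≠ p → u ≠ q → v ≠ p → v ≠ q →
      (H'.Adj u v ↔ (G.comap (ψ.trans χ)).Adj u v) := by
    intro u v hup huq hvp hvq
    exact hχ _ _ (ψ.injective.ne hup) (ψ.injective.ne huq) (ψ.injective.ne hvp)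
      (ψ.injective.ne hvq)
  have hE := Walk.edges_mem_of_agree_off_pair hag Z hp hq
  have hZ' := (hZ.transfer hE).map (f := (SimpleGraph.Iso.comap (ψ.trans χ) G).toHom)
    (SimpleGraph.Iso.comap (ψ.trans χ) G).injective
  have := hg _ _ hZ'
  rwa [Walk.length_map, Walk.length_transfer] at this
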